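/- Let N be a positive integer, J, D, H ∈ ℝ^{N×N} with J skew-symmetric, D symmetric positive semidefinite, H symmetric positive definite. Let e : [t₀,T] → ℝ^N be continuously differentiable with ė(t) = (J−D)H e(t) + r(t) and e(t₀) = 0, where r : [t₀,T] → ℝ^N is continuous. Let V_A ∈ ℝ^{N×n_A} have full column rank, let ε_r : [t₀,T] → ℝ^{n_A} be continuously differentiable with V_AᵀHV_A ε̇_r(t) = V_AᵀH(J−D)HV_A ε_r(t) + V_AᵀH r(t) and ε_r(t₀) = 0, and set ê_A(t) := V_A ε_r(t), P_A := I_N − V_A(V_AᵀHV_A)⁻¹V_AᵀH, and r_A(t) := P_A (J−D)H ê_A(t) + P_A r(t). Then for all t ∈ [t₀,T], ‖e(t)‖_H ≤ Δ_A(t) := ‖ê_A(t)‖_H + ∫_{t₀}^{t} ‖r_A(s)‖_H ds (the auxiliary-linear-problem error bound). -/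

import Mathlib

open Matrix

/-- The energy norm `‖z‖_H := (zᵀ H z)^{1/2}` induced by a symmetric positive
definite matrix `H`. -/
noncomputable def energyNorm {N : ℕ} (H : Matrix (Fin N) (Fin N) ℝ)
    (z : Fin N → ℝ) : ℝ :=
  Real.sqrt (z ⬝ᵥ (H *ᵥ z))

/-- The projection operator `P := I − V (VᵀHV)⁻¹ VᵀH` associated with a reduced
basis `V` and a symmetric positive definite matrix `H`. -/
noncomputable def proj {N n : ℕ} (H : Matrix (Fin N) (Fin N) ℝ)
    (V : Matrix (Fin N) (Fin n) ℝ) : Matrix (Fin N) (Fin N) ℝ :=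
  1 - V * (Vᵀ * H * V)⁻¹ * (Vᵀ * H)

section EnergyNorm

variable {N : ℕ} {H : Matrix (Fin N) (Fin N) ℝ}

theorem energyNorm_nonneg (z : Fin N → ℝ) : 0 ≤ energyNorm H z :=
  Real.sqrt_nonneg _

theorem energyNorm_sq (hH : H.PosSemidef) (z : Fin N → ℝ) :
    energyNorm H z ^ 2 = z ⬝ᵥ (H *ᵥ z) :=
  Real.sq_sqrt (by simpa using hH.dotProduct_mulVec_nonneg z)

theorem dotProduct_mulVec_symm (hH : Hᵀ = H) (x y : Fin N → ℝ) :
    x ⬝ᵥ (H *ᵥ y) = y ⬝ᵥ (H *ᵥ x) := by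
  rw [dotProduct_mulVec, ← mulVec_transpose, hH, dotProduct_comm]

/-- The **Cauchy-Schwarz inequality** for the energy inner product. -/
theorem dotProduct_mulVec_le_energyNorm_mul (hH : H.PosSemidef) (x y : Fin N → ℝ) :
    x ⬝ᵥ (H *ᵥ y) ≤ energyNorm H x * energyNorm H y := by
  have hsymm : Hᵀ = H := by simpa using hH.isHermitian.eq
  refine abs_le_of_sq_le_sq' ?_ (mul_nonneg (energyNorm_nonneg _) (energyNorm_nonneg _)) |>.2
  rw [mul_pow, energyNorm_sq hH, energyNorm_sq hH, sq]
  have h := LinearMap.BilinForm.apply_mul_apply_le_of_forall_zero_le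
    (Matrix.toLinearMap₂' ℝ H)
    (fun x => by simpa [toLinearMap₂'_apply'] using hH.dotProduct_mulVec_nonneg x) x y
  simp only [toLinearMap₂'_apply'] at h
  rwa [dotProduct_mulVec_symm hsymm y x] at h

theorem energyNorm_add_le (hH : H.PosSemidef) (x y : Fin N → ℝ) :
    energyNorm H (x + y) ≤ energyNorm H x + energyNorm H y := by
  refine abs_le_of_sq_le_sq' ?_ (add_nonneg (energyNorm_nonneg _) (energyNorm_nonneg _)) |>.2
  have hsymm : Hᵀ = H := by simpa using hH.isHermitian.eq
  have h := dotProduct_mulVec_le_energyNorm_mul hH x y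
  rw [energyNorm_sq hH, add_sq, energyNorm_sq hH, energyNorm_sq hH, mulVec_add, add_dotProduct,
    dotProduct_add, dotProduct_add, dotProduct_mulVec_symm hsymm y x]
  linarith

theorem continuous_energyNorm : Continuous (energyNorm H) :=
  (continuous_id.dotProduct (continuous_const.matrix_mulVec continuous_id)).sqrt

end EnergyNorm

theorem HasDerivAt.const_mulVec {m n : ℕ} (A : Matrix (Fin m) (Fin n) ℝ) {x : ℝ → Fin n → ℝ}
    {x' : Fin n → ℝ} {t : ℝ} (hx : HasDerivAt x x' t) :
    HasDerivAt (fun s => A *ᵥ x s) (A *ᵥ x') t :=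
  (LinearMap.toContinuousLinearMap A.mulVecLin).hasFDerivAt.comp_hasDerivAt t hx

theorem HasDerivAt.dotProduct {n : ℕ} {x y : ℝ → Fin n → ℝ} {x' y' : Fin n → ℝ} {t : ℝ}
    (hx : HasDerivAt x x' t) (hy : HasDerivAt y y' t) :
    HasDerivAt (fun s => x s ⬝ᵥ y s) (x' ⬝ᵥ y t + x t ⬝ᵥ y') t := by
  simp only [_root_.dotProduct, ← Finset.sum_add_distrib]
  exact HasDerivAt.fun_sum fun i _ => (hasDerivAt_pi.1 hx i).mul (hasDerivAt_pi.1 hy i)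

/-- The power balance of a port-Hamiltonian system: only the input can increase the energy. -/
theorem dotProduct_skew_sub_dissipation_nonpos {N : ℕ} {J D : Matrix (Fin N) (Fin N) ℝ}
    (hJ : Jᵀ = -J) (hD : D.PosSemidef) (x : Fin N → ℝ) : x ⬝ᵥ ((J - D) *ᵥ x) ≤ 0 := by
  have hskew : x ⬝ᵥ (J *ᵥ x) = -(x ⬝ᵥ (J *ᵥ x)) := by
    conv_lhs => rw [dotProduct_mulVec, ← mulVec_transpose, hJ, neg_mulVec, neg_dotProduct,
      dotProduct_comm]
  have hdiss : 0 ≤ x ⬝ᵥ (D *ᵥ x) := by simpa using hD.dotProduct_mulVec_nonneg x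
  rw [sub_mulVec, dotProduct_sub]
  linarith

/-- The energy norm of the state of a port-Hamiltonian system with zero initial value is at most
the integral of the energy norm of the input. -/
theorem energyNorm_le_integral_energyNorm_input {N : ℕ} {J D H : Matrix (Fin N) (Fin N) ℝ}
    (hJ : Jᵀ = -J) (hD : D.PosSemidef) (hH : H.PosSemidef) {a b : ℝ} (hab : a ≤ b)
    {z f : ℝ → Fin N → ℝ} (hf : ContinuousOn f (Set.Icc a b))
    (hz : ∀ t ∈ Set.Icc a b, HasDerivAt z (((J - D) * H) *ᵥ z t + f t) t) (hza : z a = 0) :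
    energyNorm H (z b) ≤ ∫ s in a..b, energyNorm H (f s) := by
  have hsymm : Hᵀ = H := by simpa using hH.isHermitian.eq
  -- The norm is not differentiable at zero, so it is regularized by `δ`.
  refine le_of_forall_pos_le_add fun δ hδ => ?_
  set E : ℝ → ℝ := fun t => z t ⬝ᵥ (H *ᵥ z t) + δ ^ 2 with hE_def
  have hE_eq (t : ℝ) : E t = energyNorm H (z t) ^ 2 + δ ^ 2 := by
    rw [energyNorm_sq hH]
  have hE_pos (t : ℝ) : 0 < E t := by
    rw [hE_eq]; positivity
  have hE_deriv (t : ℝ) (ht : t ∈ Set.Icc a b) : HasDerivAt (fun s => √(E s))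
      (2 * (z t ⬝ᵥ (H *ᵥ (((J - D) * H) *ᵥ z t + f t))) / (2 * √(E t))) t := by
    refine HasDerivAt.sqrt ?_ (hE_pos t).ne'
    refine (((hz t ht).dotProduct ((hz t ht).const_mulVec H)).add_const (δ ^ 2)).congr_deriv ?_
    rw [dotProduct_mulVec_symm hsymm _ (z t), two_mul]
  have hbound (t : ℝ) : 2 * (z t ⬝ᵥ (H *ᵥ (((J - D) * H) *ᵥ z t + f t))) / (2 * √(E t))
      ≤ energyNorm H (f t) := by
    have hle : energyNorm H (z t) ≤ √(E t) :=
      Real.sqrt_le_sqrt (by simp only [hE_def]; nlinarith)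
    have hbalance := dotProduct_skew_sub_dissipation_nonpos hJ hD (H *ᵥ z t)
    have hcs := dotProduct_mulVec_le_energyNorm_mul hH (z t) (f t)
    have hmul := mul_le_mul_of_nonneg_right hle (energyNorm_nonneg (H := H) (f t))
    have hsplit : z t ⬝ᵥ (H *ᵥ (((J - D) * H) *ᵥ z t + f t))
        = (H *ᵥ z t) ⬝ᵥ ((J - D) *ᵥ (H *ᵥ z t)) + z t ⬝ᵥ (H *ᵥ f t) := by
      rw [mulVec_add, dotProduct_add, ← mulVec_mulVec, dotProduct_mulVec_symm hsymm,
        dotProduct_comm]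
    rw [mul_div_mul_left _ _ two_ne_zero, div_le_iff₀ (Real.sqrt_pos.2 (hE_pos t)), hsplit]
    linarith
  have hint := intervalIntegral.sub_le_integral_of_hasDeriv_right_of_le hab
    (fun t ht => (hE_deriv t ht).continuousAt.continuousWithinAt)
    (fun t ht => (hE_deriv t (Set.Ioo_subset_Icc_self ht)).hasDerivWithinAt)
    (continuous_energyNorm.comp_continuousOn hf).integrableOn_Icc
    (fun t _ => hbound t)
  have hEa : √(E a) = δ := by simp [hE_def, hza, Real.sqrt_sq hδ.le]
  have hle : energyNorm H (z b) ≤ √(E b) :=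
    Real.sqrt_le_sqrt (by simp only [hE_def]; nlinarith)
  rw [hEa] at hint
  simp only [Function.comp_apply] at hint
  linarith

/-- The Gram matrix of a reduced basis with respect to the energy inner product is invertible. -/
theorem isUnit_gram {N n : ℕ} {H : Matrix (Fin N) (Fin N) ℝ} (hH : H.PosDef)
    {V : Matrix (Fin N) (Fin n) ℝ} (hV : Function.Injective V.mulVec) :
    IsUnit (Vᵀ * H * V) := by
  simpa using (hH.conjTranspose_mul_mul_same hV).isUnit

/-- The Galerkin condition determines the derivative of the lifted reduced state. -/
theorem mulVec_eq_sub_proj_mulVec {N n : ℕ} {H : Matrix (Fin N) (Fin N) ℝ} (hH : H.PosDef)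
    {V : Matrix (Fin N) (Fin n) ℝ} (hV : Function.Injective V.mulVec)
    {x : Fin n → ℝ} {y : Fin N → ℝ} (hxy : (Vᵀ * H * V) *ᵥ x = (Vᵀ * H) *ᵥ y) :
    V *ᵥ x = y - proj H V *ᵥ y := by
  have hdet := (Matrix.isUnit_iff_isUnit_det _).1 (isUnit_gram hH hV)
  rw [proj, sub_mulVec, one_mulVec, sub_sub_cancel, ← mulVec_mulVec, ← hxy, mulVec_mulVec,
    Matrix.nonsing_inv_mul_cancel_right _ _ hdet]

/-- Auxiliary-linear-problem (ALP) error bound: with the error approximation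
`ê_A = V_A ε_r` obtained from the structure-preserving reduction of the error
system, `‖e(t)‖_H ≤ ‖ê_A(t)‖_H + ∫_{t₀}^{t} ‖r_A(s)‖_H ds`, where
`r_A = P_A (J−D)H ê_A + P_A r`. -/
theorem ALP_error_bound
    (N nA : ℕ) (hN : 0 < N)
    (J D H : Matrix (Fin N) (Fin N) ℝ)
    (hJ : Jᵀ = -J) (hD : D.PosSemidef) (hH : H.PosDef)
    (t₀ T : ℝ) (hT : t₀ ≤ T)
    (r : ℝ → Fin N → ℝ) (hr : ContinuousOn r (Set.Icc t₀ T))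
    (e : ℝ → Fin N → ℝ)
    (he : ∀ t ∈ Set.Icc t₀ T, HasDerivAt e (((J - D) * H) *ᵥ e t + r t) t)
    (he0 : e t₀ = 0)
    (VA : Matrix (Fin N) (Fin nA) ℝ) (hVA : Function.Injective VA.mulVec)
    (εr εr' : ℝ → Fin nA → ℝ)
    (hεr : ∀ t ∈ Set.Icc t₀ T, HasDerivAt εr (εr' t) t)
    (hredA : ∀ t ∈ Set.Icc t₀ T,
      (VAᵀ * H * VA) *ᵥ εr' t
        = (VAᵀ * H * ((J - D) * H) * VA) *ᵥ εr t + (VAᵀ * H) *ᵥ r t)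
    (hεr0 : εr t₀ = 0) :
    ∀ t ∈ Set.Icc t₀ T,
      energyNorm H (e t)
        ≤ energyNorm H (VA *ᵥ εr t)
          + ∫ s in t₀..t,
              energyNorm H ((proj H VA) *ᵥ (((J - D) * H) *ᵥ (VA *ᵥ εr s))
                + (proj H VA) *ᵥ r s) := by
  intro t ht
  have hsub : Set.Icc t₀ t ⊆ Set.Icc t₀ T := Set.Icc_subset_Icc_right ht.2
  have hεr_cont : ContinuousOn εr (Set.Icc t₀ t) := fun s hs =>
    (hεr s (hsub hs)).continuousAt.continuousWithinAt
  have hres_cont : ContinuousOn (fun s => proj H VA *ᵥ (((J - D) * H) *ᵥ (VA *ᵥ εr s))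
      + proj H VA *ᵥ r s) (Set.Icc t₀ t) := by
    have hmulVec {m n : ℕ} (A : Matrix (Fin m) (Fin n) ℝ) : Continuous A.mulVec :=
      continuous_const.matrix_mulVec continuous_id
    exact ((hmulVec _).comp_continuousOn ((hmulVec _).comp_continuousOn
      ((hmulVec _).comp_continuousOn hεr_cont))).add ((hmulVec _).comp_continuousOn (hr.mono hsub))
  have hdiff (s : ℝ) (hs : s ∈ Set.Icc t₀ t) : HasDerivAt (fun s => e s - VA *ᵥ εr s)
      (((J - D) * H) *ᵥ (e s - VA *ᵥ εr s) + (proj H VA *ᵥ (((J - D) * H) *ᵥ (VA *ᵥ εr s))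
        + proj H VA *ᵥ r s)) s := by
    refine ((he s (hsub hs)).sub ((hεr s (hsub hs)).const_mulVec VA)).congr_deriv ?_
    have hred : (VAᵀ * H * VA) *ᵥ εr' s
        = (VAᵀ * H) *ᵥ (((J - D) * H) *ᵥ (VA *ᵥ εr s) + r s) := by
      rw [hredA s (hsub hs), mulVec_add, mulVec_mulVec, mulVec_mulVec, Matrix.mul_assoc]
    rw [mulVec_eq_sub_proj_mulVec hH hVA hred, mulVec_sub, mulVec_add]
    abel
  have hbound := energyNorm_le_integral_energyNorm_input hJ hD hH.posSemidef ht.1 hres_cont hdiff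
    (by simp [he0, hεr0])
  have htri := energyNorm_add_le hH.posSemidef (VA *ᵥ εr t) (e t - VA *ᵥ εr t)
  rw [add_sub_cancel] at htri
  linarith
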